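/- Let η̄: ℝ^d → ℝ be a Borel function and f̄ = 1{η̄ ≥ 1/2}. If the distribution P of (X,Y) satisfies the margin assumption (MA) with parameters α ≥ 0, C₀ > 0, then for every δ > 0, R(f̄) − R(f*) ≤ 2C₀ δ^{1+α} + 2 E_X[|η̄(X) − η(X)| 1{|η̄(X) − η(X)| > δ}], where E_X denotes expectation with respect to P_X. -/

import Mathlib

open MeasureTheory ENNReal Matrix
open scoped Classical

noncomputable section

abbrev Euc (d : ℕ) := EuclideanSpace ℝ (Fin d)

/-- Margin (low noise) assumption (MA) with parameters `α`, `C₀`: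
`P_X(0 < |η(X) − 1/2| ≤ t) ≤ C₀ t^α` for all `t > 0`. -/
def margin (d : ℕ) (α C₀ : ℝ) (PX : Measure (Euc d)) (η : Euc d → ℝ) : Prop :=
  ∀ t : ℝ, 0 < t →
    PX {x | 0 < |η x - 1/2| ∧ |η x - 1/2| ≤ t} ≤ ENNReal.ofReal (C₀ * t ^ α)

/-- The plug-in rule `1{η ≥ 1/2}`; applied to the true regression function this is
the Bayes rule `f*`. -/
def plugin (d : ℕ) (η : Euc d → ℝ) : Euc d → Bool :=
  fun x => if 1/2 ≤ η x then true else false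

/-- Excess risk `R(f) − R(f*) = E[|2η(X)−1| 1{f(X) ≠ f*(X)}]`. -/
def excessRisk (d : ℕ) (PX : Measure (Euc d)) (η : Euc d → ℝ) (f : Euc d → Bool) : ℝ :=
  ∫ x, (if f x = plugin d η x then 0 else |2 * η x - 1|) ∂PX

/-- Joint distribution `P` of `(X,Y)` on `ℝ^d × ℝ` (with `Y ∈ {0,1}`) determined by the
marginal `PX` of `X` and the regression function `η(x) = P(Y = 1 | X = x)`. -/
def joint (d : ℕ) (PX : Measure (Euc d)) (η : Euc d → ℝ) : Measure (Euc d × ℝ) :=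
  PX.bind fun x =>
    ENNReal.ofReal (η x) • Measure.dirac (x, (1:ℝ)) +
      ENNReal.ofReal (1 - η x) • Measure.dirac (x, (0:ℝ))

/-- Law `P^⊗n` of the i.i.d. sample `(X₁,Y₁),…,(Xₙ,Yₙ)`. -/
def sampleLaw (d n : ℕ) (PX : Measure (Euc d)) (η : Euc d → ℝ) :
    Measure (Fin n → Euc d × ℝ) :=
  Measure.pi fun _ => joint d PX η

/-- Expected excess risk `E[R(f̂ₙ)] − R(f*)` of a classifier `f̂ₙ`. -/
def expectedExcess (d n : ℕ) (PX : Measure (Euc d)) (η : Euc d → ℝ)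
    (fhat : (Fin n → Euc d × ℝ) → Euc d → Bool) : ℝ :=
  ∫ D, excessRisk d PX η (fhat D) ∂(sampleLaw d n PX η)

/-- Excess risk `R(f) − R(f*) = E[|2η(X)−1| 1{f(X) ≠ f*(X)}]`, as an extended
nonnegative real. -/
def excessRiskE (d : ℕ) (PX : Measure (Euc d)) (η : Euc d → ℝ) (f : Euc d → Bool) : ℝ≥0∞ :=
  ∫⁻ x in {x | f x ≠ plugin d η x}, ENNReal.ofReal |2 * η x - 1| ∂PX

theorem abs_sub_half_le_of_plugin_ne {d : ℕ} {η ηbar : Euc d → ℝ} {x : Euc d}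
    (h : plugin d ηbar x ≠ plugin d η x) : |η x - 1 / 2| ≤ |ηbar x - η x| := by
  unfold plugin at h
  by_cases hbar : 1 / 2 ≤ ηbar x <;> by_cases hη : 1 / 2 ≤ η x
  · exact absurd (by simp only [hbar, hη]) h
  · rw [abs_of_nonpos (by linarith), abs_of_nonneg (by linarith)]
    linarith
  · rw [abs_of_nonneg (by linarith), abs_of_nonpos (by linarith)]
    linarith
  · exact absurd (by simp only [hbar, hη]) h

theorem measurable_plugin {d : ℕ} {η : Euc d → ℝ} (hη : Measurable η) :
    Measurable (plugin d η) :=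
  Measurable.ite (measurableSet_le measurable_const hη) measurable_const measurable_const

/-- The excess loss of a plug-in rule is bounded by a contribution of the margin region
and one of the region where the estimation error is large. -/
theorem indicator_plugin_ne_le (d : ℕ) (δ : ℝ) (η ηbar : Euc d → ℝ) (x : Euc d) :
    {x | plugin d ηbar x ≠ plugin d η x}.indicator
        (fun x => ENNReal.ofReal |2 * η x - 1|) x ≤
      {x | 0 < |η x - 1 / 2| ∧ |η x - 1 / 2| ≤ δ}.indicator
          (fun _ => ENNReal.ofReal (2 * δ)) x +
        {x | δ < |ηbar x - η x|}.indicator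
          (fun x => 2 * ENNReal.ofReal |ηbar x - η x|) x := by
  refine Set.indicator_apply_le' (fun hx => ?_) fun _ => zero_le
  have hle := abs_sub_half_le_of_plugin_ne hx
  have htwo : |2 * η x - 1| = 2 * |η x - 1 / 2| := by
    rw [← abs_two, ← abs_mul, abs_two]
    congr 1
    ring
  rw [htwo]
  by_cases hB : δ < |ηbar x - η x|
  · refine le_add_left ?_
    rw [Set.indicator_of_mem (by exact hB), ENNReal.ofReal_mul zero_le_two, ENNReal.ofReal_ofNat]
    gcongr
  · rcases (abs_nonneg (η x - 1 / 2)).eq_or_lt with h0 | h0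
    · rw [← h0, mul_zero, ENNReal.ofReal_zero]
      exact zero_le
    · have hA : |η x - 1 / 2| ≤ δ := hle.trans (not_lt.mp hB)
      refine le_add_right ?_
      rw [Set.indicator_of_mem (by exact ⟨h0, hA⟩)]
      gcongr

theorem statement17 (d : ℕ) (α C₀ δ : ℝ) (hα : 0 ≤ α) (hC₀ : 0 < C₀) (hδ : 0 < δ)
    (PX : Measure (Euc d)) (η ηbar : Euc d → ℝ) (hprob : IsProbabilityMeasure PX)
    (hmeas : Measurable η) (hmeasbar : Measurable ηbar)
    (hrange : ∀ x, η x ∈ Set.Icc (0:ℝ) 1) (hMA : margin d α C₀ PX η) :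
    excessRiskE d PX η (plugin d ηbar) ≤
      ENNReal.ofReal (2 * C₀ * δ ^ (1 + α)) +
        2 * ∫⁻ x in {x | δ < |ηbar x - η x|}, ENNReal.ofReal |ηbar x - η x| ∂PX := by
  have hD : MeasurableSet {x | plugin d ηbar x ≠ plugin d η x} :=
    (measurableSet_eq_fun (measurable_plugin hmeasbar) (measurable_plugin hmeas)).compl
  have hdist : Measurable fun x => |η x - 1 / 2| := by fun_prop
  have herr : Measurable fun x => |ηbar x - η x| := by fun_prop
  have hA : MeasurableSet {x | 0 < |η x - 1 / 2| ∧ |η x - 1 / 2| ≤ δ} :=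
    (measurableSet_lt measurable_const hdist).inter (measurableSet_le hdist measurable_const)
  have hB : MeasurableSet {x | δ < |ηbar x - η x|} := measurableSet_lt measurable_const herr
  have hpow : 2 * δ * (C₀ * δ ^ α) = 2 * C₀ * δ ^ (1 + α) := by
    rw [Real.rpow_add hδ, Real.rpow_one]
    ring
  unfold excessRiskE
  rw [← lintegral_indicator hD]
  refine (lintegral_mono (indicator_plugin_ne_le d δ η ηbar)).trans ?_
  rw [lintegral_add_left (measurable_const.indicator hA), lintegral_indicator_const hA,
    lintegral_indicator hB, lintegral_const_mul _ herr.ennreal_ofReal]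
  gcongr
  rw [← hpow, ENNReal.ofReal_mul (by positivity : 0 ≤ 2 * δ)]
  gcongr
  exact hMA δ hδ
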